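/- For t > 0, the total probability 𝒩_N(t,x) = ∫_{y_1 < ... < y_N} det_{1≤i,j≤N}((2πt)^{-1/2} e^{-(x_j-y_i)²/(2t)}) dy satisfies the asymptotics 𝒩_N(t,x) = (1/c̄_N) h_N(x/√t) (1 + O(|x|/√t)) as |x|/√t → 0, where h_N(x) = ∏_{i<j}(x_j - x_i) and c̄_N = π^{N/2} ∏_{j=1}^N Γ(j)/Γ(j/2). -/

import Mathlib

open Finset MeasureTheory Real

/-- The sign function with values in `ℝ`, as a monoid homomorphism. -/
noncomputable def signR : ℝ →*₀ ℝ := SignType.castHom.comp signHom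

lemma signR_apply (a : ℝ) : signR a = ((SignType.sign a : SignType) : ℝ) := rfl

lemma signR_of_pos {a : ℝ} (h : 0 < a) : signR a = 1 := by
  simp [signR_apply, sign_pos h]

lemma signR_of_neg {a : ℝ} (h : a < 0) : signR a = -1 := by
  simp [signR_apply, sign_neg h]

lemma signR_neg (a : ℝ) : signR (-a) = -signR a := by
  rcases lt_trichotomy a 0 with h | rfl | h
  · rw [signR_of_neg h, signR_of_pos (neg_pos.2 h), neg_neg]
  · simp
  · rw [signR_of_pos h, signR_of_neg (neg_lt_zero.2 h)]

lemma signR_sub_comm (a b : ℝ) : signR (a - b) = -signR (b - a) := by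
  rw [← signR_neg, neg_sub]

lemma signR_mul_self {a : ℝ} (h : a ≠ 0) : signR a * signR a = 1 := by
  rcases h.lt_or_gt with h | h
  · simp [signR_of_neg h]
  · simp [signR_of_pos h]

lemma abs_signR_le (a : ℝ) : |signR a| ≤ 1 := by
  rcases lt_trichotomy a 0 with h | rfl | h
  · simp [signR_of_neg h]
  · simp
  · simp [signR_of_pos h]

lemma measurable_signR : Measurable signR := by
  have : (signR : ℝ → ℝ) = fun a => if 0 < a then 1 else if a < 0 then -1 else 0 := by
    funext a
    rcases lt_trichotomy a 0 with h | rfl | h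
    · simp [signR_of_neg h, h, not_lt.2 h.le]
    · simp
    · simp [signR_of_pos h, h]
  rw [this]
  exact Measurable.ite measurableSet_Ioi measurable_const
    (Measurable.ite measurableSet_Iio measurable_const measurable_const)

lemma sum_prod_signR_erase (S : Finset ℝ) :
    ∑ a ∈ S, ∏ b ∈ S.erase a, signR (a - b) = if Odd #S then 1 else 0 := by
  induction S using Finset.induction_on_max with
  | empty => simp
  | insert m S hm ih =>
    have hmS : m ∉ S := fun h => lt_irrefl _ (hm m h)
    have h1 : ∏ b ∈ S, signR (m - b) = 1 :=
      Finset.prod_eq_one fun b hb => signR_of_pos (sub_pos.2 (hm b hb))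
    have h2 : ∀ a ∈ S, ∏ b ∈ (insert m S).erase a, signR (a - b)
        = -∏ b ∈ S.erase a, signR (a - b) := by
      intro a ha
      have hne : m ≠ a := (hm a ha).ne'
      rw [Finset.erase_insert_of_ne hne, Finset.prod_insert (by simp [hmS]),
        signR_of_neg (sub_neg.2 (hm a ha))]
      ring
    rw [Finset.sum_insert hmS, Finset.erase_insert hmS, h1, Finset.sum_congr rfl h2,
      Finset.sum_neg_distrib, ih, Finset.card_insert_of_notMem hmS]
    by_cases h : Odd #S
    · simp [h, Nat.odd_add_one]
    · simp [h, Nat.odd_add_one]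

lemma prod_signR_sub_eq {S : Finset ℝ} {u : ℝ} (hu : u ∉ S) :
    ∏ b ∈ S, signR (u - b) = (if Odd (#S + 1) then 1 else 0)
      + ∑ a ∈ S, (∏ b ∈ S.erase a, signR (a - b)) * signR (u - a) := by
  have h := sum_prod_signR_erase (insert u S)
  have h2 : ∀ a ∈ S, ∏ b ∈ (insert u S).erase a, signR (a - b)
      = -((∏ b ∈ S.erase a, signR (a - b)) * signR (u - a)) := by
    intro a ha
    have hne : u ≠ a := fun h => hu (h ▸ ha)
    rw [Finset.erase_insert_of_ne hne, Finset.prod_insert (by simp [hu]), signR_sub_comm]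
    ring
  rw [Finset.sum_insert hu, Finset.erase_insert hu, Finset.sum_congr rfl h2,
    Finset.sum_neg_distrib, Finset.card_insert_of_notMem hu] at h
  linarith

lemma integral_signR_sub_mul_deriv {G g : ℝ → ℝ} (hG : ∀ u, HasDerivAt G (g u) u)
    (hGi : Integrable G) (hg : Integrable g) (a : ℝ) :
    ∫ u, signR (u - a) * g u = -2 * G a := by
  have hsgn : Integrable fun u => signR (u - a) * g u :=
    hg.bdd_mul (c := 1) (measurable_signR.comp (measurable_id.sub_const a)).aestronglyMeasurable
      (Filter.Eventually.of_forall fun u => abs_signR_le _)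
  have A : Filter.Tendsto G Filter.atBot (nhds 0) :=
    tendsto_zero_of_hasDerivAt_of_integrableOn_Iic (a := 0) (fun x _ => hG x)
      hg.integrableOn hGi.integrableOn
  have B : Filter.Tendsto G Filter.atTop (nhds 0) :=
    tendsto_zero_of_hasDerivAt_of_integrableOn_Ioi (a := 0) (fun x _ => hG x)
      hg.integrableOn hGi.integrableOn
  have hA := integral_Iic_of_hasDerivAt_of_tendsto' (a := a) (fun x _ => hG x) hg.integrableOn A
  have hB := integral_Ioi_of_hasDerivAt_of_tendsto' (a := a) (fun x _ => hG x) hg.integrableOn B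
  rw [← setIntegral_univ, ← Set.Iic_union_Ioi (a := a),
    setIntegral_union (Set.Iic_disjoint_Ioi le_rfl) measurableSet_Ioi hsgn.integrableOn
      hsgn.integrableOn, integral_Iic_eq_integral_Iio,
    setIntegral_congr_fun (g := fun u => -g u) measurableSet_Iio
      (fun u hu => by simp [signR_of_neg (sub_neg.2 hu)]),
    setIntegral_congr_fun (g := g) measurableSet_Ioi
      (fun u hu => by simp [signR_of_pos (sub_pos.2 hu)]),
    integral_neg, ← integral_Iic_eq_integral_Iio, hA, hB]
  ring

lemma integral_prod_signR_sub_mul_deriv {G g : ℝ → ℝ} (hG : ∀ u, HasDerivAt G (g u) u)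
    (hGi : Integrable G) (hg : Integrable g) (S : Finset ℝ) :
    ∫ u, (∏ b ∈ S, signR (u - b)) * g u
      = -2 * ∑ a ∈ S, G a * ∏ b ∈ S.erase a, signR (a - b) := by
  have hsgn : ∀ a, Integrable fun u => signR (u - a) * g u := fun a =>
    hg.bdd_mul (c := 1) (measurable_signR.comp (measurable_id.sub_const a)).aestronglyMeasurable
      (Filter.Eventually.of_forall fun u => abs_signR_le _)
  have h0 := integral_eq_zero_of_hasDerivAt_of_integrable hG hg hGi
  have hae : ∀ᵐ u : ℝ, u ∉ S := by
    have : (volume : Measure ℝ) (S : Set ℝ) = 0 := S.finite_toSet.measure_zero _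
    simpa using measure_eq_zero_iff_ae_notMem.1 this
  have : (fun u => (∏ b ∈ S, signR (u - b)) * g u) =ᵐ[volume]
      fun u => (if Odd (#S + 1) then 1 else 0) * g u
        + ∑ a ∈ S, (∏ b ∈ S.erase a, signR (a - b)) * (signR (u - a) * g u) := by
    filter_upwards [hae] with u hu
    rw [prod_signR_sub_eq hu, add_mul, Finset.sum_mul]
    simp only [mul_assoc]
  rw [integral_congr_ae this, integral_add (hg.const_mul _)
    (integrable_finsetSum _ fun a _ => (hsgn a).const_mul _), integral_const_mul, h0,
    integral_finsetSum _ fun a _ => (hsgn a).const_mul _, Finset.mul_sum, mul_zero, zero_add]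
  refine Finset.sum_congr rfl fun a _ => ?_
  rw [integral_const_mul, integral_signR_sub_mul_deriv hG hGi hg]
  ring

lemma integral_prod_signR_sub_mul_deriv_of_injective {G g : ℝ → ℝ}
    (hG : ∀ u, HasDerivAt G (g u) u) (hGi : Integrable G) (hg : Integrable g) {m : ℕ}
    {y : Fin (m + 1) → ℝ} (hy : Function.Injective y) :
    ∫ u, (∏ i, signR (u - y i)) * g u
      = -2 * ∑ k, G (y k) * ∏ i : Fin m, signR (y k - y (k.succAbove i)) := by
  have h := integral_prod_signR_sub_mul_deriv hG hGi hg (univ.map ⟨y, hy⟩)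
  simp only [Finset.prod_map, Finset.sum_map, Function.Embedding.coeFn_mk] at h
  rw [h]
  congr 1
  refine Finset.sum_congr rfl fun k _ => ?_
  congr 1
  have : (univ.map ⟨y, hy⟩).erase (y k) = (univ.map (Fin.succAboveEmb k)).map ⟨y, hy⟩ := by
    ext a
    simp only [Finset.mem_erase, Finset.mem_map, Finset.mem_univ, true_and,
      Function.Embedding.coeFn_mk, Fin.succAboveEmb_apply, exists_exists_eq_and]
    constructor
    · rintro ⟨h1, j, rfl⟩
      obtain ⟨i, hi⟩ := Fin.exists_succAbove_eq (x := j) (y := k) (fun h => h1 (by rw [h]))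
      exact ⟨i, by rw [hi]⟩
    · rintro ⟨i, rfl⟩
      exact ⟨fun h => Fin.succAbove_ne k i (hy h), _, rfl⟩
  rw [this, Finset.prod_map, Finset.prod_map]
  rfl

/-- The sign of the Vandermonde product of a tuple of reals. -/
noncomputable def vandermondeSign {n : ℕ} (y : Fin n → ℝ) : ℝ :=
  ∏ i, ∏ j ∈ Ioi i, signR (y j - y i)

lemma abs_vandermondeSign_le {n : ℕ} (y : Fin n → ℝ) : |vandermondeSign y| ≤ 1 := by
  simp only [vandermondeSign, Finset.abs_prod]
  exact Finset.prod_le_one (fun _ _ => Finset.prod_nonneg fun _ _ => abs_nonneg _) fun _ _ =>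
    Finset.prod_le_one (fun _ _ => abs_nonneg _) fun _ _ => abs_signR_le _

lemma measurable_vandermondeSign {n : ℕ} :
    Measurable (vandermondeSign : (Fin n → ℝ) → ℝ) := by
  refine Finset.measurable_prod _ fun i _ => Finset.measurable_prod _ fun j _ => ?_
  exact measurable_signR.comp ((measurable_pi_apply j).sub (measurable_pi_apply i))

lemma vandermondeSign_of_strictMono {n : ℕ} {y : Fin n → ℝ} (hy : StrictMono y) :
    vandermondeSign y = 1 :=
  Finset.prod_eq_one fun _ _ => Finset.prod_eq_one fun _ hj =>
    signR_of_pos (sub_pos.2 (hy (Finset.mem_Ioi.1 hj)))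

lemma vandermondeSign_comp_perm {n : ℕ} (y : Fin n → ℝ) (σ : Equiv.Perm (Fin n)) :
    vandermondeSign (y ∘ σ) = σ.sign * vandermondeSign y := by
  exact σ.prod_Ioi_comp_eq_sign_mul_prod (f := fun i j => signR (y j - y i))
    fun i j => signR_sub_comm _ _

lemma vandermondeSign_eq_ite {n : ℕ} (y : Fin n → ℝ) :
    vandermondeSign y = ∏ i, ∏ j, if i < j then signR (y j - y i) else 1 := by
  refine Finset.prod_congr rfl fun i _ => ?_
  rw [← Finset.prod_filter]
  congr 1
  ext; simp

lemma vandermondeSign_succAbove {n : ℕ} (y : Fin (n + 1) → ℝ) (k : Fin (n + 1)) :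
    vandermondeSign y = (∏ i, if k.succAbove i < k then 1 else -1)
      * (∏ i, signR (y k - y (k.succAbove i))) * vandermondeSign (y ∘ k.succAbove) := by
  simp only [vandermondeSign_eq_ite]
  rw [Fin.prod_univ_succAbove _ k, Fin.prod_univ_succAbove _ k]
  simp only [lt_irrefl, if_false, one_mul]
  simp_rw [Fin.prod_univ_succAbove _ k]
  rw [Finset.prod_mul_distrib, ← mul_assoc]
  congr 1
  · rw [← Finset.prod_mul_distrib, ← Finset.prod_mul_distrib]
    refine Finset.prod_congr rfl fun i _ => ?_
    rcases lt_or_gt_of_ne (Fin.succAbove_ne k i) with h | h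
    · simp [h, h.not_gt]
    · simp [h, h.not_gt, signR_sub_comm (y k)]
  · simp only [Function.comp, Fin.succAbove_lt_succAbove_iff]

lemma vandermondeSign_mul_prod_signR {n : ℕ} {y : Fin (n + 1) → ℝ} (hy : Function.Injective y)
    (k : Fin (n + 1)) :
    vandermondeSign y * ∏ i, signR (y k - y (k.succAbove i))
      = (∏ i, if k.succAbove i < k then 1 else -1) * vandermondeSign (y ∘ k.succAbove) := by
  have h : (∏ i, signR (y k - y (k.succAbove i))) * ∏ i, signR (y k - y (k.succAbove i)) = 1 := by
    rw [← Finset.prod_mul_distrib]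
    exact Finset.prod_eq_one fun i _ => signR_mul_self
      (sub_ne_zero.2 fun h => Fin.succAbove_ne k i (hy h).symm)
  rw [vandermondeSign_succAbove y k]
  linear_combination ((∏ i, if k.succAbove i < k then (1:ℝ) else -1)
    * vandermondeSign (y ∘ k.succAbove)) * h

lemma ae_injective (n : ℕ) : ∀ᵐ y : Fin n → ℝ, Function.Injective y := by
  have h : ∀ i j : Fin n, i ≠ j → ∀ᵐ y : Fin n → ℝ, y i ≠ y j := by
    intro i j hij
    let s : Submodule ℝ (Fin n → ℝ) :=
      LinearMap.ker (LinearMap.proj (R := ℝ) (φ := fun _ : Fin n => ℝ) i - LinearMap.proj j)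
    have hs : s ≠ ⊤ := by
      intro hs
      have : Pi.single i (1 : ℝ) ∈ s := hs ▸ Submodule.mem_top
      simp [s, LinearMap.mem_ker, Pi.single_eq_of_ne hij.symm] at this
    filter_upwards [measure_eq_zero_iff_ae_notMem.1 (Measure.addHaar_submodule volume s hs)]
      with y hy h
    exact hy (by simp [s, LinearMap.mem_ker, h])
  have h2 : ∀ᵐ y : Fin n → ℝ, ∀ i j, i ≠ j → y i ≠ y j := by
    rw [ae_all_iff]; intro i
    rw [ae_all_iff]; intro j
    by_cases hij : i = j
    · simp [hij]
    · filter_upwards [h i j hij] with y hy _ using hy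
  filter_upwards [h2] with y hy i j hij
  by_contra hne
  exact hy i j hne hij

lemma vandermondeSign_eq_sum {n : ℕ} {y : Fin n → ℝ} (hy : Function.Injective y) :
    vandermondeSign y
      = ∑ σ : Equiv.Perm (Fin n), (σ.sign : ℝ) * {z | StrictMono z}.indicator 1 (y ∘ σ) := by
  have hsm : StrictMono (y ∘ Tuple.sort y) :=
    (Tuple.monotone_sort y).strictMono_of_injective (hy.comp (Tuple.sort y).injective)
  rw [Finset.sum_eq_single (Tuple.sort y)]
  · have h := vandermondeSign_comp_perm y (Tuple.sort y)
    rw [vandermondeSign_of_strictMono hsm] at h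
    rw [Set.indicator_of_mem (by exact hsm), Pi.one_apply, mul_one]
    rcases Int.units_eq_one_or (Equiv.Perm.sign (Tuple.sort y)) with h1 | h1 <;>
      rw [h1] at h ⊢ <;> push_cast at h ⊢ <;> linarith
  · intro σ _ hσ
    rw [Set.indicator_of_notMem, mul_zero]
    intro h
    apply hσ
    have := Tuple.unique_monotone (f := y) (StrictMono.monotone h) (Tuple.monotone_sort y)
    exact Equiv.ext fun i => hy (congrFun this i)
  · simp

lemma measurableSet_strictMono (n : ℕ) : MeasurableSet {y : Fin n → ℝ | StrictMono y} := by
  have : {y : Fin n → ℝ | StrictMono y} = ⋂ i, ⋂ j, ⋂ _ : i < j, {y | y i < y j} := by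
    ext y; simp [StrictMono]
  rw [this]
  exact MeasurableSet.iInter fun i => MeasurableSet.iInter fun j => MeasurableSet.iInter fun _ =>
    measurableSet_lt (measurable_pi_apply i) (measurable_pi_apply j)

lemma integral_comp_perm {n : ℕ} (f : (Fin n → ℝ) → ℝ) (σ : Equiv.Perm (Fin n)) :
    ∫ y, f (y ∘ σ) = ∫ y, f y := by
  have h := (volume_measurePreserving_piCongrLeft (fun _ : Fin n => ℝ) σ.symm).integral_comp' f
  rw [← h]
  congr 1
  funext y
  congr 1
  funext i
  have := Equiv.piCongrLeft_apply_apply (fun _ : Fin n => ℝ) σ.symm y (σ i)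
  simp only [Equiv.symm_apply_apply] at this
  simp [MeasurableEquiv.coe_piCongrLeft, this]

/-- The integral of `∏ i, φ i (y i)` against the sign of the Vandermonde product. -/
noncomputable def signedIntegral {n : ℕ} (φ : Fin n → ℝ → ℝ) : ℝ :=
  ∫ y : Fin n → ℝ, vandermondeSign y * ∏ i, φ i (y i)

lemma integrable_vandermondeSign_mul_prod {n : ℕ} {φ : Fin n → ℝ → ℝ}
    (hφ : ∀ i, Integrable (φ i)) :
    Integrable fun y : Fin n → ℝ => vandermondeSign y * ∏ i, φ i (y i) :=
  (Integrable.fintype_prod hφ).bdd_mul (c := 1) measurable_vandermondeSign.aestronglyMeasurable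
    (Filter.Eventually.of_forall fun _ => abs_vandermondeSign_le _)

lemma setIntegral_det_eq_signedIntegral {n : ℕ} {φ : Fin n → ℝ → ℝ}
    (hφ : ∀ i, Integrable (φ i)) :
    ∫ y in {y : Fin n → ℝ | StrictMono y}, Matrix.det (Matrix.of fun i j => φ j (y i))
      = signedIntegral φ := by
  have hprod : ∀ σ : Equiv.Perm (Fin n),
      Integrable fun y : Fin n → ℝ => ∏ i, φ i (y (σ i)) := by
    intro σ
    have : (fun y : Fin n → ℝ => ∏ i, φ i (y (σ i)))
        = fun y : Fin n → ℝ => ∏ i, φ (σ.symm i) (y i) := by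
      funext y
      rw [← Equiv.prod_comp σ (fun i => φ (σ.symm i) (y i))]
      simp
    rw [this]
    exact Integrable.fintype_prod fun i => hφ _
  have h1 : signedIntegral φ = ∑ σ : Equiv.Perm (Fin n), ∫ y : Fin n → ℝ,
      (σ.sign : ℝ) * {z | StrictMono z}.indicator (fun z => ∏ i, φ i (z (σ.symm i))) (y ∘ σ) := by
    have hae : (fun y : Fin n → ℝ => vandermondeSign y * ∏ i, φ i (y i)) =ᵐ[volume]
        fun y => ∑ σ : Equiv.Perm (Fin n), (σ.sign : ℝ)
          * {z | StrictMono z}.indicator (fun z => ∏ i, φ i (z (σ.symm i))) (y ∘ σ) := by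
      filter_upwards [ae_injective n] with y hy
      rw [vandermondeSign_eq_sum hy, Finset.sum_mul]
      refine Finset.sum_congr rfl fun σ _ => ?_
      rw [mul_assoc]
      congr 1
      by_cases h : StrictMono (y ∘ σ)
      · rw [Set.indicator_of_mem (by exact h), Set.indicator_of_mem (by exact h)]
        simp
      · rw [Set.indicator_of_notMem (by exact h), Set.indicator_of_notMem (by exact h), zero_mul]
    rw [signedIntegral, integral_congr_ae hae, integral_finsetSum]
    intro σ _
    refine Integrable.const_mul ?_ _
    have : (fun y : Fin n → ℝ => {z | StrictMono z}.indicator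
        (fun z => ∏ i, φ i (z (σ.symm i))) (y ∘ σ))
        = {y : Fin n → ℝ | StrictMono (y ∘ σ)}.indicator fun y => ∏ i, φ i (y i) := by
      funext y
      by_cases h : StrictMono (y ∘ σ)
      · rw [Set.indicator_of_mem (by exact h), Set.indicator_of_mem (by exact h)]
        simp
      · rw [Set.indicator_of_notMem (by exact h), Set.indicator_of_notMem (by exact h)]
    rw [this]
    refine (Integrable.fintype_prod hφ).indicator ?_
    exact (measurableSet_strictMono n).preimage
      (measurable_pi_lambda (fun y : Fin n → ℝ => y ∘ σ) fun i => measurable_pi_apply (σ i))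
  rw [h1]
  have h2 : ∀ σ : Equiv.Perm (Fin n), ∫ y : Fin n → ℝ,
      (σ.sign : ℝ) * {z | StrictMono z}.indicator (fun z => ∏ i, φ i (z (σ.symm i))) (y ∘ σ)
      = ∫ y in {y : Fin n → ℝ | StrictMono y}, (σ.sign : ℝ) * ∏ i, φ i (y (σ.symm i)) := by
    intro σ
    rw [integral_const_mul, integral_comp_perm ({z | StrictMono z}.indicator
      fun z => ∏ i, φ i (z (σ.symm i))) σ, integral_indicator (measurableSet_strictMono n),
      integral_const_mul]
  rw [Finset.sum_congr rfl fun σ _ => h2 σ]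
  rw [← integral_finsetSum _ fun σ _ => ((hprod σ.symm).integrableOn.const_mul _)]
  congr 1
  funext y
  rw [Matrix.det_apply']
  rw [← Equiv.sum_comp (Equiv.inv (Equiv.Perm (Fin n)))]
  refine Finset.sum_congr rfl fun σ _ => ?_
  simp [← Equiv.Perm.inv_def]

lemma integral_vandermondeSign_comp_succAbove {m : ℕ} (G : ℝ → ℝ) (φ : Fin (m + 1) → ℝ → ℝ)
    (k : Fin (m + 1)) :
    ∫ y : Fin (m + 1) → ℝ, vandermondeSign (y ∘ k.succAbove) * (G (y k) * ∏ i, φ i (y i))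
      = (∫ u, G u * φ k u) * signedIntegral fun i => φ (k.succAbove i) := by
  have h := (volume_preserving_piFinSuccAbove (fun _ : Fin (m + 1) => ℝ) k).integral_comp'
    (fun p : ℝ × (Fin m → ℝ) => (G p.1 * φ k p.1)
      * (vandermondeSign p.2 * ∏ i, φ (k.succAbove i) (p.2 i)))
  rw [signedIntegral, ← integral_prod_mul, ← Measure.volume_eq_prod, ← h]
  congr 1
  funext y
  rw [Fin.prod_univ_succAbove _ k]
  have h1 : ((MeasurableEquiv.piFinSuccAbove (fun _ : Fin (m + 1) => ℝ) k) y).1 = y k := rfl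
  have h2 : ((MeasurableEquiv.piFinSuccAbove (fun _ : Fin (m + 1) => ℝ) k) y).2
    = y ∘ k.succAbove := rfl
  rw [h1, h2]
  simp only [Function.comp]
  ring

lemma signedIntegral_of_hasDerivAt_last {m : ℕ} {φ : Fin (m + 2) → ℝ → ℝ} {G : ℝ → ℝ}
    (hφ : ∀ i, Integrable (φ i)) (hG : ∀ u, HasDerivAt G (φ (Fin.last _) u) u)
    (hGi : Integrable G)
    (hGφ : ∀ i : Fin (m + 1), Integrable fun u => G u * φ i.castSucc u) :
    signedIntegral φ = -2 * ∑ k : Fin (m + 1), (∏ i, if k.succAbove i < k then 1 else -1)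
      * ((∫ u, G u * φ k.castSucc u)
        * signedIntegral fun i => φ (k.succAbove i).castSucc) := by
  have hmp := volume_preserving_piFinSuccAbove (fun _ : Fin (m + 2) => ℝ) (Fin.last (m + 1))
  let F : ℝ × (Fin (m + 1) → ℝ) → ℝ := fun p =>
    (vandermondeSign p.2 * ∏ i, φ i.castSucc (p.2 i))
      * ((∏ i, signR (p.1 - p.2 i)) * φ (Fin.last _) p.1)
  have hF : (fun y : Fin (m + 2) → ℝ => vandermondeSign y * ∏ i, φ i (y i))
      = fun y => F (MeasurableEquiv.piFinSuccAbove (fun _ : Fin (m + 2) => ℝ)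
        (Fin.last (m + 1)) y) := by
    funext y
    have h1 : ((MeasurableEquiv.piFinSuccAbove (fun _ : Fin (m + 2) => ℝ)
      (Fin.last (m + 1))) y).1 = y (Fin.last _) := rfl
    have h2 : ((MeasurableEquiv.piFinSuccAbove (fun _ : Fin (m + 2) => ℝ)
      (Fin.last (m + 1))) y).2 = y ∘ Fin.castSucc := by
      funext i
      exact congrArg y (Fin.succAbove_last_apply i)
    simp only [F, h1, h2, Function.comp]
    rw [vandermondeSign_succAbove y (Fin.last _), Fin.prod_univ_castSucc fun i => φ i (y i)]
    simp only [Fin.succAbove_last, Fin.castSucc_lt_last, if_true, Finset.prod_const_one, one_mul]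
    have h3 : (y ∘ Fin.castSucc) = fun i : Fin (m + 1) => y i.castSucc := rfl
    rw [h3]
    ring
  have hFi : Integrable F := by
    rw [← hmp.integrable_comp_emb (MeasurableEquiv.measurableEmbedding _)]
    have := integrable_vandermondeSign_mul_prod hφ
    rw [hF] at this
    exact this
  rw [signedIntegral, hF, hmp.integral_comp', Measure.volume_eq_prod, integral_prod_symm]
  swap
  · rwa [← Measure.volume_eq_prod]
  have hae : (fun y : Fin (m + 1) → ℝ => ∫ u, F (u, y)) =ᵐ[volume] fun y =>
      -2 * ∑ k : Fin (m + 1), (∏ i, if k.succAbove i < k then 1 else -1)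
        * (vandermondeSign (y ∘ k.succAbove) * (G (y k) * ∏ i : Fin (m + 1), φ i.castSucc (y i))) := by
    filter_upwards [ae_injective (m + 1)] with y hy
    simp only [F]
    rw [integral_const_mul, integral_prod_signR_sub_mul_deriv_of_injective hG hGi (hφ _) hy,
      mul_left_comm, Finset.mul_sum]
    congr 1
    refine Finset.sum_congr rfl fun k _ => ?_
    linear_combination (G (y k) * ∏ i : Fin (m + 1), φ i.castSucc (y i))
      * vandermondeSign_mul_prod_signR hy k
  rw [integral_congr_ae hae, integral_const_mul, integral_finsetSum]
  · congr 1
    refine Finset.sum_congr rfl fun k _ => ?_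
    rw [integral_const_mul,
      integral_vandermondeSign_comp_succAbove G (fun i : Fin (m + 1) => φ i.castSucc) k]
  · intro k _
    refine Integrable.const_mul ?_ _
    refine Integrable.bdd_mul (c := 1) ?_ ?_
      (Filter.Eventually.of_forall fun _ => abs_vandermondeSign_le _)
    · have : (fun y : Fin (m + 1) → ℝ => G (y k) * ∏ i : Fin (m + 1), φ i.castSucc (y i))
          = fun y => ∏ i : Fin (m + 1), (if i = k then fun u => G u * φ i.castSucc u
            else φ i.castSucc) (y i) := by
        funext y
        rw [Fin.prod_univ_succAbove _ k, Fin.prod_univ_succAbove _ k, ← mul_assoc]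
        simp
      rw [this]
      refine Integrable.fintype_prod fun i => ?_
      split_ifs
      · exact hGφ i
      · exact hφ _
    · exact (measurable_vandermondeSign.comp (measurable_pi_lambda _
        fun i => measurable_pi_apply (k.succAbove i))).aestronglyMeasurable

lemma integrable_eval_mul_exp {c : ℝ} (hc : 0 < c) (p : Polynomial ℝ) :
    Integrable fun u => p.eval u * exp (-c * u ^ 2) := by
  induction p using Polynomial.induction_on' with
  | add p q hp hq =>
    simp only [Polynomial.eval_add, add_mul]
    exact hp.add hq
  | monomial n a =>
    simp only [Polynomial.eval_monomial, mul_assoc]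
    refine Integrable.const_mul ?_ a
    have := integrable_rpow_mul_exp_neg_mul_sq hc (s := n) (by
      have : (0 : ℝ) ≤ n := n.cast_nonneg
      linarith)
    simpa only [Real.rpow_natCast] using this

lemma hasDerivAt_eval_mul_exp (c : ℝ) (p : Polynomial ℝ) (u : ℝ) :
    HasDerivAt (fun u => p.eval u * exp (-c * u ^ 2))
      ((p.derivative - Polynomial.C (2 * c) * Polynomial.X * p).eval u * exp (-c * u ^ 2)) u := by
  have h := (p.hasDerivAt u).mul (((hasDerivAt_pow 2 u).const_mul (-c)).exp)
  convert! h using 1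
  simp
  ring

/-- The monic Hermite polynomials for the weight `exp (-u ^ 2)`. -/
noncomputable def monicHermite : ℕ → Polynomial ℝ
  | 0 => 1
  | n + 1 => Polynomial.X * monicHermite n
      - Polynomial.C (1 / 2) * (monicHermite n).derivative

open Polynomial in
lemma Polynomial.Monic.X_mul_sub_C_mul_derivative {p : ℝ[X]} (hp : p.Monic) (c : ℝ) :
    (X * p - C c * derivative p).Monic
      ∧ (X * p - C c * derivative p).natDegree = p.natDegree + 1 := by
  have h1 : (X * p).Monic := monic_X.mul hp
  have h2 : (X * p).degree = ((p.natDegree + 1 : ℕ) : WithBot ℕ) := by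
    rw [degree_eq_natDegree h1.ne_zero, natDegree_X_mul hp.ne_zero]
  have h3 : (C c * derivative p).degree < (X * p).degree := by
    rw [h2]
    refine degree_le_natDegree.trans_lt ?_
    norm_cast
    exact Nat.lt_succ_of_le ((natDegree_C_mul_le _ _).trans
      ((natDegree_derivative_le p).trans (Nat.sub_le _ _)))
  refine ⟨h1.sub_of_left h3, ?_⟩
  rw [natDegree_eq_of_degree_eq (degree_sub_eq_left_of_degree_lt h3), natDegree_X_mul hp.ne_zero]

lemma monicHermite_monic_natDegree (n : ℕ) :
    (monicHermite n).Monic ∧ (monicHermite n).natDegree = n := by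
  induction n with
  | zero => exact ⟨Polynomial.monic_one, Polynomial.natDegree_one⟩
  | succ n ih =>
    have := ih.1.X_mul_sub_C_mul_derivative (1 / 2)
    rw [ih.2] at this
    exact this

lemma integral_monicHermite_mul (n : ℕ) (p : Polynomial ℝ) :
    ∫ u, (monicHermite n * p).eval u * exp (-1 * u ^ 2)
      = (1 / 2) ^ n * ∫ u, (Polynomial.derivative^[n] p).eval u * exp (-1 * u ^ 2) := by
  induction n generalizing p with
  | zero => simp [monicHermite]
  | succ n ih =>
    have h := integral_eq_zero_of_hasDerivAt_of_integrable
      (hasDerivAt_eval_mul_exp 1 (monicHermite n * p))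
      (integrable_eval_mul_exp one_pos _) (integrable_eval_mul_exp one_pos _)
    have hpoly : (monicHermite n * p).derivative
        - Polynomial.C (2 * 1) * Polynomial.X * (monicHermite n * p)
        = monicHermite n * p.derivative - Polynomial.C 2 * (monicHermite (n + 1) * p) := by
      have h2 : (Polynomial.C 2 : Polynomial ℝ) * Polynomial.C (1 / 2) = 1 := by
        rw [← Polynomial.C_mul]; norm_num
      rw [Polynomial.derivative_mul, monicHermite, mul_one]
      linear_combination (-(monicHermite n).derivative * p) * h2
    rw [hpoly] at h
    simp only [Polynomial.eval_sub, sub_mul, Polynomial.eval_C_mul, mul_assoc] at h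
    rw [integral_sub (integrable_eval_mul_exp one_pos _)
      ((integrable_eval_mul_exp one_pos _).const_mul _), integral_const_mul, ih] at h
    rw [Function.iterate_succ_apply, pow_succ]
    linarith

lemma integral_monicHermite_mul_X_pow_of_lt {n k : ℕ} (hk : k < n) :
    ∫ u, (monicHermite n * Polynomial.X ^ k).eval u * exp (-1 * u ^ 2) = 0 := by
  rw [integral_monicHermite_mul, Polynomial.iterate_derivative_eq_zero (by simpa using hk)]
  simp

lemma integral_monicHermite_mul_X_pow_self (n : ℕ) :
    ∫ u, (monicHermite n * Polynomial.X ^ n).eval u * exp (-1 * u ^ 2)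
      = (1 / 2) ^ n * (n.factorial * √π) := by
  rw [integral_monicHermite_mul, Polynomial.iterate_derivative_X_pow_eq_natCast_mul]
  have h : ∫ u : ℝ, exp (-1 * u ^ 2) = √π := by rw [integral_gaussian, div_one]
  simp only [Nat.descFactorial_self, Nat.sub_self, pow_zero, mul_one, Polynomial.eval_natCast,
    integral_const_mul, h]

/-- The integral of the Vandermonde determinant against the standard Gaussian weight over the
Weyl chamber. -/
noncomputable def weylGaussianIntegral (n : ℕ) : ℝ :=
  ∫ y in {y : Fin n → ℝ | StrictMono y},
    (Matrix.vandermonde y).det * ∏ i, exp (-(1 / 2) * y i ^ 2)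

lemma weylGaussianIntegral_eq_signedIntegral {n : ℕ} (p : Fin n → Polynomial ℝ)
    (hdeg : ∀ i, (p i).natDegree = i) (hmonic : ∀ i, (p i).Monic) :
    weylGaussianIntegral n
      = signedIntegral fun i u => (p i).eval u * exp (-(1 / 2) * u ^ 2) := by
  rw [← setIntegral_det_eq_signedIntegral fun i => integrable_eval_mul_exp (by norm_num) (p i),
    weylGaussianIntegral]
  congr 1
  funext y
  rw [Matrix.det_eval_matrixOfPolynomials_eq_det_vandermonde y p hdeg hmonic, mul_comm,
    ← Matrix.det_mul_column]
  congr 1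
  ext i j
  simp [mul_comm]

lemma weylGaussianIntegral_add_two (n : ℕ) :
    weylGaussianIntegral (n + 2)
      = 2 * ((1 / 2) ^ n * (n.factorial * √π)) * weylGaussianIntegral n := by
  let q := monicHermite n
  have hq := monicHermite_monic_natDegree n
  have hlast := hq.1.X_mul_sub_C_mul_derivative 1
  let p : Fin (n + 2) → Polynomial ℝ := Fin.lastCases
    (Polynomial.X * q - Polynomial.C 1 * q.derivative) (fun i => Polynomial.X ^ (i : ℕ))
  have hp_last : p (Fin.last _) = Polynomial.X * q - Polynomial.C 1 * q.derivative := by simp [p]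
  have hp_cast : ∀ i : Fin (n + 1), p i.castSucc = Polynomial.X ^ (i : ℕ) := by simp [p]
  have hdeg : ∀ i, (p i).natDegree = i := by
    refine Fin.lastCases ?_ fun i => ?_
    · rw [hp_last, hlast.2, hq.2]; simp
    · rw [hp_cast]; simp
  have hmonic : ∀ i, (p i).Monic := by
    refine Fin.lastCases ?_ fun i => ?_
    · rw [hp_last]; exact hlast.1
    · rw [hp_cast]; exact Polynomial.monic_X_pow _
  have hhalf : (0 : ℝ) < 1 / 2 := by norm_num
  let G : ℝ → ℝ := fun u => (-q).eval u * exp (-(1 / 2) * u ^ 2)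
  have hGmul : ∀ k : Fin (n + 1), (fun u => G u * ((p k.castSucc).eval u
      * exp (-(1 / 2) * u ^ 2)))
      = fun u => -((monicHermite n * Polynomial.X ^ (k : ℕ)).eval u * exp (-1 * u ^ 2)) := by
    intro k
    funext u
    have : exp (-1 * u ^ 2) = exp (-(1 / 2) * u ^ 2) * exp (-(1 / 2) * u ^ 2) := by
      rw [← Real.exp_add]; ring_nf
    rw [hp_cast, this]
    simp only [G, q, Polynomial.eval_neg, Polynomial.eval_mul]
    ring
  rw [weylGaussianIntegral_eq_signedIntegral p hdeg hmonic,
    signedIntegral_of_hasDerivAt_last (G := G) (fun i => integrable_eval_mul_exp hhalf _) ?_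
      (integrable_eval_mul_exp hhalf _) ?_, Fin.sum_univ_castSucc]
  · rw [Finset.sum_eq_zero, hGmul, integral_neg]
    · simp only [Fin.val_last, integral_monicHermite_mul_X_pow_self, Fin.succAbove_last,
        Fin.castSucc_lt_last, if_true, Finset.prod_const_one, hp_cast]
      rw [weylGaussianIntegral_eq_signedIntegral (fun i => Polynomial.X ^ (i : ℕ))
        (fun i => by simp) (fun i => Polynomial.monic_X_pow _)]
      simp only [Fin.val_castSucc]
      ring
    · intro k _
      rw [hGmul, integral_neg, integral_monicHermite_mul_X_pow_of_lt (by simp)]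
      simp
  · intro u
    have h := hasDerivAt_eval_mul_exp (1 / 2) (-q) u
    convert! h using 2
    rw [hp_last]
    congr 1
    simp
    ring
  · intro i
    rw [hGmul]
    exact (integrable_eval_mul_exp one_pos _).neg

lemma weylGaussianIntegral_zero : weylGaussianIntegral 0 = 1 := by
  have : {y : Fin 0 → ℝ | StrictMono y} = Set.univ :=
    Set.eq_univ_of_forall fun y => Subsingleton.strictMono y
  simp [weylGaussianIntegral, this, measureReal_def, volume_pi, Measure.pi_empty_univ]

lemma weylGaussianIntegral_one : weylGaussianIntegral 1 = √(2 * π) := by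
  rw [weylGaussianIntegral_eq_signedIntegral (fun _ => 1) (by simp) (by simp), signedIntegral]
  have h : ∀ y : Fin 1 → ℝ, vandermondeSign y = 1 := fun y =>
    vandermondeSign_of_strictMono (Subsingleton.strictMono y)
  simp only [h, one_mul]
  rw [integral_fintype_prod_volume_eq_prod
    (fun (_ : Fin 1) u => (1 : Polynomial ℝ).eval u * exp (-(1 / 2) * u ^ 2))]
  simp only [Polynomial.eval_one, one_mul, integral_gaussian]
  simp [mul_comm]

lemma weylGaussianIntegral_mul (n : ℕ) :
    weylGaussianIntegral n * (π ^ ((n : ℝ) / 2) * ∏ j ∈ Icc 1 n, Gamma j / Gamma (j / 2))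
      = √(2 * π) ^ n * ∏ j ∈ range n, (j.factorial : ℝ) := by
  induction n using Nat.twoStepInduction with
  | zero => simp [weylGaussianIntegral_zero]
  | one =>
    rw [weylGaussianIntegral_one]
    simp only [Nat.cast_one, Icc_self, prod_singleton, Gamma_one, Gamma_one_half_eq,
      ← Real.sqrt_eq_rpow]
    simp [Real.sqrt_ne_zero', pi_pos]
  | more n ih _ =>
    have hdup := Real.Gamma_mul_Gamma_add_half (((n + 1 : ℕ) : ℝ) / 2)
    have hp1 : 0 < Gamma (((n + 1 : ℕ) : ℝ) / 2) := Gamma_pos_of_pos (by positivity)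
    have hp2 : 0 < Gamma (((n + 2 : ℕ) : ℝ) / 2) := Gamma_pos_of_pos (by positivity)
    rw [show ((n + 1 : ℕ) : ℝ) / 2 + 1 / 2 = ((n + 2 : ℕ) : ℝ) / 2 by push_cast; ring,
      show 2 * (((n + 1 : ℕ) : ℝ) / 2) = (n : ℝ) + 1 by push_cast; ring, Gamma_nat_eq_factorial,
      show 1 - ((n : ℝ) + 1) = -(n : ℝ) by ring, Real.rpow_neg two_pos.le, Real.rpow_natCast]
      at hdup
    have hpi : π ^ (((n + 2 : ℕ) : ℝ) / 2) = π ^ ((n : ℝ) / 2) * π := by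
      rw [show ((n + 2 : ℕ) : ℝ) / 2 = (n : ℝ) / 2 + 1 by push_cast; ring, rpow_add pi_pos,
        rpow_one]
    have hg1 : Gamma ((n + 1 : ℕ) : ℝ) = n.factorial := by
      rw [Nat.cast_add_one, Gamma_nat_eq_factorial]
    have hg2 : Gamma ((n + 2 : ℕ) : ℝ) = (n + 1).factorial := by
      rw [show ((n + 2 : ℕ) : ℝ) = ((n + 1 : ℕ) : ℝ) + 1 by push_cast; ring,
        Gamma_nat_eq_factorial]
    rw [weylGaussianIntegral_add_two, hpi, Finset.prod_Icc_succ_top (by omega),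
      Finset.prod_Icc_succ_top (by omega), Finset.prod_range_succ, Finset.prod_range_succ,
      hg1, hg2, pow_add, Real.sq_sqrt (by positivity)]
    have key : 2 * ((1 / 2) ^ n * (n.factorial * √π)) * π
        * ((n.factorial / Gamma (((n + 1 : ℕ) : ℝ) / 2))
          * ((n + 1).factorial / Gamma (((n + 2 : ℕ) : ℝ) / 2)))
        = 2 * π * (n.factorial * (n + 1).factorial) := by
      rw [div_mul_div_comm, hdup]
      have : (0 : ℝ) < n.factorial := by positivity
      field_simp
      rw [← mul_pow]
      norm_num
    linear_combination (2 * π * (n.factorial * (n + 1).factorial)) * ih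
      + (weylGaussianIntegral n * (π ^ ((n : ℝ) / 2)
        * ∏ j ∈ Icc 1 n, Gamma j / Gamma (j / 2))) * key

lemma exists_iteratedDeriv_eq_zero {n : ℕ} {f : ℝ → ℝ} (hf : ∀ m : ℕ, ContDiff ℝ m f)
    {z : Fin (n + 1) → ℝ} (hz : StrictMono z) (h0 : ∀ i, f (z i) = 0) {a b : ℝ}
    (hab : ∀ i, z i ∈ Set.Icc a b) : ∃ ξ ∈ Set.Icc a b, iteratedDeriv n f ξ = 0 := by
  induction n generalizing f with
  | zero => exact ⟨z 0, hab 0, by simpa using h0 0⟩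
  | succ n ih =>
    have hrolle : ∀ i : Fin (n + 1), ∃ c ∈ Set.Ioo (z i.castSucc) (z i.succ), deriv f c = 0 :=
      fun i => exists_deriv_eq_zero (hz Fin.castSucc_lt_succ) (hf 0).continuous.continuousOn
        (by rw [h0, h0])
    choose c hc hc0 using hrolle
    have hmono : StrictMono c := by
      refine Fin.strictMono_iff_lt_succ.2 fun i => ?_
      have h2 := (hc i.succ).1
      rw [← Fin.succ_castSucc] at h2
      exact (hc i.castSucc).2.trans h2
    have hderiv : ∀ m : ℕ, ContDiff ℝ m (deriv f) := fun m =>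
      (contDiff_succ_iff_deriv.1 (by exact_mod_cast hf (m + 1))).2.2
    obtain ⟨ξ, hξ, h⟩ := ih hderiv hmono hc0 fun i =>
      ⟨(hab i.castSucc).1.trans (hc i).1.le, (hc i).2.le.trans (hab i.succ).2⟩
    exact ⟨ξ, hξ, by rw [iteratedDeriv_succ', h]⟩

lemma Polynomial.iteratedDeriv_eval (p : Polynomial ℝ) (n : ℕ) :
    iteratedDeriv n (fun s => p.eval s) = fun s => (Polynomial.derivative^[n] p).eval s := by
  induction n generalizing p with
  | zero => simp
  | succ n ih =>
    rw [iteratedDeriv_succ', Function.iterate_succ_apply, ← ih]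
    congr 1
    funext s
    exact p.deriv

/-- The error formula for Lagrange interpolation of a function vanishing at the nodes. -/
lemma exists_mul_factorial_eq_iteratedDeriv_mul_prod {k : ℕ} {f : ℝ → ℝ}
    (hf : ∀ m : ℕ, ContDiff ℝ m f) {z : Fin (k + 1) → ℝ} (hz : StrictMono z)
    (h0 : ∀ i : Fin k, f (z i.castSucc) = 0) {a b : ℝ} (hab : ∀ i, z i ∈ Set.Icc a b) :
    ∃ ξ ∈ Set.Icc a b, f (z (Fin.last k)) * k.factorial
      = (∏ i : Fin k, (z (Fin.last k) - z i.castSucc)) * iteratedDeriv k f ξ := by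
  let P : Polynomial ℝ := ∏ i : Fin k, (Polynomial.X - Polynomial.C (z i.castSucc))
  have hPm : P.Monic := Polynomial.monic_prod_of_monic _ _ fun i _ => Polynomial.monic_X_sub_C _
  have hPd : P.natDegree = k := by
    rw [Polynomial.natDegree_prod_of_monic _ _ fun i _ => Polynomial.monic_X_sub_C (z i.castSucc)]
    simp
  have hPe : ∀ s, P.eval s = ∏ i : Fin k, (s - z i.castSucc) := fun s => by
    simp [P, Polynomial.eval_prod]
  have hP0 : P.eval (z (Fin.last k)) ≠ 0 := by
    rw [hPe]
    exact Finset.prod_ne_zero_iff.2 fun i _ => sub_ne_zero.2 (hz (Fin.castSucc_lt_last i)).ne'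
  have hPk : ∀ s, (Polynomial.derivative^[k] P).eval s = k.factorial := by
    intro s
    have h := Polynomial.natDegree_iterate_derivative P k
    rw [hPd, Nat.sub_self, Nat.le_zero] at h
    have hlead : P.coeff k = 1 := by
      have := hPm.coeff_natDegree
      rwa [hPd] at this
    rw [Polynomial.eq_C_of_natDegree_eq_zero h, Polynomial.eval_C,
      Polynomial.coeff_iterate_derivative, zero_add, hlead, Nat.descFactorial_self]
    simp
  set c := f (z (Fin.last k)) / P.eval (z (Fin.last k)) with hc
  have hPc : ∀ m : ℕ, ContDiff ℝ m fun s => c * P.eval s := fun m =>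
    contDiff_const.mul (by
      simp only [hPe]
      fun_prop)
  obtain ⟨ξ, hξ, h⟩ := exists_iteratedDeriv_eq_zero (f := fun s => f s - c * P.eval s)
    (fun m => (hf m).sub (hPc m)) hz (fun i => by
      induction i using Fin.lastCases with
      | last => rw [hc]; field_simp; ring
      | cast i =>
        rw [h0, hPe, Finset.prod_eq_zero (Finset.mem_univ i) (sub_self _)]
        ring) hab
  refine ⟨ξ, hξ, ?_⟩
  rw [iteratedDeriv_fun_sub (hf k).contDiffAt (hPc k).contDiffAt,
    iteratedDeriv_const_mul_field, Polynomial.iteratedDeriv_eval] at h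
  simp only [hPk] at h
  rw [← hPe]
  have : c * P.eval (z (Fin.last k)) = f (z (Fin.last k)) := by rw [hc]; field_simp
  linear_combination (-(k.factorial : ℝ)) * this - P.eval (z (Fin.last k)) * h

lemma iteratedDeriv_sum_mul_exp {ι : Type*} (S : Finset ι) (c y : ι → ℝ) (k : ℕ) :
    iteratedDeriv k (fun s => ∑ i ∈ S, exp (s * y i) * c i)
      = fun s => ∑ i ∈ S, (y i ^ k * exp (s * y i)) * c i := by
  induction k generalizing c with
  | zero => simp
  | succ k ih =>
    have hd : deriv (fun s => ∑ i ∈ S, exp (s * y i) * c i)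
        = fun s => ∑ i ∈ S, exp (s * y i) * (y i * c i) := by
      funext s
      refine HasDerivAt.deriv (HasDerivAt.fun_sum fun i _ => ?_)
      convert! (((hasDerivAt_id s).mul_const (y i)).exp).mul_const (c i) using 1
      simp
      ring
    rw [iteratedDeriv_succ', hd, ih]
    funext s
    refine Finset.sum_congr rfl fun i _ => ?_
    ring

lemma prod_ite_le_eq_mul {N k : ℕ} (hk : k < N) (F : Fin N → ℝ) :
    (∏ j : Fin N, if k ≤ (j : ℕ) then F j else 1)
      = F ⟨k, hk⟩ * ∏ j : Fin N, if k + 1 ≤ (j : ℕ) then F j else 1 := by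
  rw [← Finset.mul_prod_erase univ _ (Finset.mem_univ (⟨k, hk⟩ : Fin N)),
    ← Finset.mul_prod_erase univ (fun j : Fin N => if k + 1 ≤ (j : ℕ) then F j else 1)
      (Finset.mem_univ (⟨k, hk⟩ : Fin N))]
  simp only [le_refl, if_true, Nat.not_succ_le_self, if_false, one_mul]
  congr 1
  refine Finset.prod_congr rfl fun j hj => ?_
  have : (j : ℕ) ≠ k := fun h => (Finset.mem_erase.1 hj).1 (Fin.ext h)
  have : k ≤ (j : ℕ) ↔ k + 1 ≤ (j : ℕ) := by omega
  simp only [this]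

lemma exists_det_exp_mul_prod_factorial_eq_partial {N : ℕ} {x : Fin N → ℝ} (hx : StrictMono x)
    (y : Fin N → ℝ) {a b : ℝ} (hab : ∀ i, x i ∈ Set.Icc a b) {k : ℕ} (hk : k ≤ N) :
    ∃ ξ : Fin N → ℝ, (∀ j, ξ j ∈ Set.Icc a b) ∧
      (Matrix.of fun i j => exp (x j * y i)).det
          * (∏ j : Fin N, if k ≤ (j : ℕ) then ((j : ℕ).factorial : ℝ) else 1)
        = (∏ j : Fin N, if k ≤ (j : ℕ) then ∏ i ∈ Iio j, (x j - x i) else 1)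
          * (Matrix.of fun i j : Fin N => if (j : ℕ) < k then exp (x j * y i)
              else y i ^ (j : ℕ) * exp (ξ j * y i)).det := by
  induction hk using Nat.decreasingInduction with
  | self =>
    refine ⟨x, hab, ?_⟩
    simp [fun j : Fin N => not_le.2 j.is_lt]
  | of_succ k hk ih =>
    obtain ⟨ξ, hξ, h⟩ := ih
    set A : Matrix (Fin N) (Fin N) ℝ := Matrix.of fun i j : Fin N =>
      if (j : ℕ) < k + 1 then exp (x j * y i) else y i ^ (j : ℕ) * exp (ξ j * y i) with hA
    let j₀ : Fin N := ⟨k, hk⟩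
    let c : Fin N → ℝ := fun i => (A.updateCol j₀ fun j => if i = j then 1 else 0).det
    have hlin : ∀ v : Fin N → ℝ, (A.updateCol j₀ v).det = ∑ i, v i * c i := by
      intro v
      have := LinearMap.pi_apply_eq_sum_univ
        ((LinearMap.proj (R := ℝ) (φ := fun _ : Fin N => ℝ) j₀).comp (Matrix.cramer A)) v
      simpa [Matrix.cramer_apply, c] using this
    let g : ℝ → ℝ := fun s => ∑ i, exp (s * y i) * c i
    have hg : ∀ s, g s = (A.updateCol j₀ fun i => exp (s * y i)).det := fun s => (hlin _).symm
    have hgc : ∀ m : ℕ, ContDiff ℝ m g := fun m => by fun_prop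
    obtain ⟨η, hη, hg2⟩ := exists_mul_factorial_eq_iteratedDeriv_mul_prod hgc
      (z := fun i : Fin (k + 1) => x (Fin.castLE hk i))
      (fun i j hij => hx (by simpa using hij))
      (fun i => by
        rw [hg]
        refine Matrix.det_zero_of_column_eq (i := Fin.castLE hk i.castSucc) (j := j₀) ?_ ?_
        · intro h
          have := congrArg Fin.val h
          simp [j₀] at this
          omega
        · intro l
          have hne : Fin.castLE hk i.castSucc ≠ j₀ := by
            intro h
            have := congrArg Fin.val h
            simp [j₀] at this
            omega
          rw [Matrix.updateCol_ne hne, Matrix.updateCol_self]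
          simp only [hA, Matrix.of_apply, Fin.val_castLE, Fin.val_castSucc]
          rw [if_pos (by omega)])
      (fun i => hab _)
    have hlast : (Fin.castLE hk (Fin.last k)) = j₀ := Fin.ext (by simp [j₀])
    have hprod : ∏ i : Fin k, (x j₀ - x (Fin.castLE hk i.castSucc))
        = ∏ i ∈ Iio j₀, (x j₀ - x i) := by
      refine Finset.prod_bij (fun i _ => Fin.castLE hk i.castSucc) ?_ ?_ ?_ ?_
      · intro i _
        exact Finset.mem_Iio.2 (Fin.lt_def.2 (by simp [j₀]))
      · intro i _ j _ hij
        simpa [Fin.ext_iff] using hij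
      · intro j hj
        exact ⟨⟨j, Fin.lt_def.1 (Finset.mem_Iio.1 hj)⟩, Finset.mem_univ _, Fin.ext (by simp)⟩
      · intros; rfl
    simp only [hlast, hprod] at hg2
    have hgA : g (x j₀) = A.det := by
      rw [hg]
      congr 1
      ext i j
      rcases eq_or_ne j j₀ with rfl | hj
      · rw [Matrix.updateCol_self]
        simp [hA, j₀]
      · rw [Matrix.updateCol_ne hj]
    refine ⟨Function.update ξ j₀ η, ?_, ?_⟩
    · intro j
      rcases eq_or_ne j j₀ with rfl | hj
      · simpa using hη
      · simpa [Function.update_of_ne hj] using hξ j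
    · have hB : (Matrix.of fun i j : Fin N => if (j : ℕ) < k then exp (x j * y i)
          else y i ^ (j : ℕ) * exp (Function.update ξ j₀ η j * y i))
          = A.updateCol j₀ fun i => y i ^ k * exp (η * y i) := by
        ext i j
        rcases eq_or_ne j j₀ with rfl | hj
        · rw [Matrix.updateCol_self]
          simp [j₀]
        · have hjk : (j : ℕ) ≠ k := fun h => hj (Fin.ext h)
          have hiff : (j : ℕ) < k ↔ (j : ℕ) < k + 1 := by omega
          rw [Matrix.updateCol_ne hj]
          simp [hA, Function.update_of_ne hj, hiff]
      rw [hB, prod_ite_le_eq_mul hk, prod_ite_le_eq_mul hk, hlin]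
      rw [iteratedDeriv_sum_mul_exp, hgA] at hg2
      change _ * (((k : ℕ).factorial : ℝ) * _) = (∏ i ∈ Iio j₀, (x j₀ - x i)) * _ * _
      linear_combination (k.factorial : ℝ) * h
        + (∏ j : Fin N, if k + 1 ≤ (j : ℕ) then ∏ i ∈ Iio j, (x j - x i) else 1) * hg2

/-- A mean value theorem for the determinant of exponentials. -/
lemma exists_det_exp_mul_prod_factorial_eq {N : ℕ} {x : Fin N → ℝ} (hx : StrictMono x)
    (y : Fin N → ℝ) {a b : ℝ} (hab : ∀ i, x i ∈ Set.Icc a b) :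
    ∃ ξ : Fin N → ℝ, (∀ j, ξ j ∈ Set.Icc a b) ∧
      (Matrix.of fun i j => exp (x j * y i)).det * (∏ j : Fin N, ((j : ℕ).factorial : ℝ))
        = (∏ i, ∏ j ∈ Ioi i, (x j - x i))
          * (Matrix.of fun i j : Fin N => y i ^ (j : ℕ) * exp (ξ j * y i)).det := by
  obtain ⟨ξ, hξ, h⟩ := exists_det_exp_mul_prod_factorial_eq_partial hx y hab (Nat.zero_le N)
  refine ⟨ξ, hξ, ?_⟩
  have hcomm : ∏ i, ∏ j ∈ Ioi i, (x j - x i) = ∏ j, ∏ i ∈ Iio j, (x j - x i) :=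
    Finset.prod_comm' (by simp)
  simpa [hcomm] using h

lemma abs_exp_sub_one_le_mul_exp (a : ℝ) : |exp a - 1| ≤ |a| * exp |a| := by
  have hpos := Real.exp_pos a
  rcases le_total 0 a with ha | ha
  · rw [abs_of_nonneg ha, abs_of_nonneg (by linarith [Real.one_le_exp ha])]
    have h1 := Real.add_one_le_exp (-a)
    have h2 : exp (-a) * exp a = 1 := by rw [← Real.exp_add]; simp
    nlinarith
  · rw [abs_of_nonpos ha, abs_of_nonpos (by linarith [Real.exp_le_one_iff.2 ha])]
    have h1 := Real.add_one_le_exp a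
    have h2 : 1 ≤ exp (-a) := Real.one_le_exp (by linarith)
    nlinarith

lemma abs_sum_sign_mul_prod_pow_le {N : ℕ} (y : Fin N → ℝ) {c : Equiv.Perm (Fin N) → ℝ} {B : ℝ}
    (hc : ∀ σ, |c σ| ≤ B) :
    |∑ σ : Equiv.Perm (Fin N), (σ.sign : ℝ) * ((∏ i, y (σ i) ^ (i : ℕ)) * c σ)|
      ≤ N.factorial * ((∏ i : Fin N, ((i : ℕ).factorial : ℝ)) * exp (∑ i, |y i|) * B) := by
  refine (Finset.abs_sum_le_sum_abs _ _).trans ?_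
  rw [show (N.factorial : ℝ) = #(univ : Finset (Equiv.Perm (Fin N))) by
    simp [Fintype.card_perm], ← nsmul_eq_mul]
  refine Finset.sum_le_card_nsmul _ _ _ fun σ _ => ?_
  have hsign : |((σ.sign : ℤ) : ℝ)| = 1 := by
    rcases Int.units_eq_one_or σ.sign with h | h <;> simp [h]
  rw [abs_mul, hsign, one_mul, abs_mul, Finset.abs_prod]
  refine mul_le_mul ?_ (hc σ) (abs_nonneg _) (by positivity)
  rw [← Equiv.sum_comp σ fun i => |y i|, Real.exp_sum, ← Finset.prod_mul_distrib]
  refine Finset.prod_le_prod (fun _ _ => abs_nonneg _) fun i _ => ?_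
  rw [abs_pow]
  have := Real.pow_div_factorial_le_exp |y (σ i)| (abs_nonneg _) (i : ℕ)
  rwa [div_le_iff₀' (by positivity)] at this

lemma abs_det_vandermonde_le {N : ℕ} (y : Fin N → ℝ) :
    |(Matrix.vandermonde y).det|
      ≤ N.factorial * (∏ i : Fin N, ((i : ℕ).factorial : ℝ)) * ∏ i, exp (3 * |y i|) := by
  have h := abs_sum_sign_mul_prod_pow_le y (c := fun _ => 1) (B := exp (2 * ∑ i, |y i|))
    fun σ => by
      rw [abs_one]
      exact Real.one_le_exp (by positivity)
  rw [mul_assoc, ← Real.exp_add] at h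
  rw [Matrix.det_apply', ← Real.exp_sum, ← Finset.mul_sum, mul_assoc]
  simp only [Matrix.vandermonde_apply]
  convert! h using 4
  · simp
  · ring

lemma abs_det_pow_mul_exp_sub_det_vandermonde_le {N : ℕ} (y : Fin N → ℝ) {ξ : Fin N → ℝ} {M : ℝ}
    (hξ : ∀ j, |ξ j| ≤ M) (hM0 : 0 ≤ M) (hM1 : M ≤ 1) :
    |(Matrix.of fun i j : Fin N => y i ^ (j : ℕ) * exp (ξ j * y i)).det
        - (Matrix.vandermonde y).det|
      ≤ M * (N.factorial * (∏ i : Fin N, ((i : ℕ).factorial : ℝ)) * ∏ i, exp (3 * |y i|)) := by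
  set T := ∑ i, |y i| with hT
  have hT0 : 0 ≤ T := Finset.sum_nonneg fun _ _ => abs_nonneg _
  have h := abs_sum_sign_mul_prod_pow_le y (c := fun σ => exp (∑ i, ξ i * y (σ i)) - 1)
    (B := M * exp (2 * T)) fun σ => by
      have ha : |∑ i, ξ i * y (σ i)| ≤ M * T := by
        rw [hT, ← Equiv.sum_comp σ fun i => |y i|, Finset.mul_sum]
        refine (Finset.abs_sum_le_sum_abs _ _).trans (Finset.sum_le_sum fun i _ => ?_)
        rw [abs_mul]
        exact mul_le_mul_of_nonneg_right (hξ i) (abs_nonneg _)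
      have hTe : T ≤ exp T := by linarith [Real.add_one_le_exp T]
      calc _ ≤ |∑ i, ξ i * y (σ i)| * exp |∑ i, ξ i * y (σ i)| := abs_exp_sub_one_le_mul_exp _
        _ ≤ (M * exp T) * exp T := by
            refine mul_le_mul (ha.trans (by gcongr)) (Real.exp_le_exp.2 (ha.trans ?_))
              (Real.exp_pos _).le (by positivity)
            nlinarith
        _ = M * exp (2 * T) := by rw [mul_assoc, ← Real.exp_add]; ring_nf
  have hexp : exp (3 * T) = exp T * exp (2 * T) := by rw [← Real.exp_add]; ring_nf
  rw [Matrix.det_apply', Matrix.det_apply', ← Finset.sum_sub_distrib, ← Real.exp_sum,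
    ← Finset.mul_sum, ← hT, hexp]
  convert! h using 1
  · congr 1
    refine Finset.sum_congr rfl fun σ _ => ?_
    simp only [Matrix.of_apply, Matrix.vandermonde_apply, Finset.prod_mul_distrib, Real.exp_sum]
    ring
  · ring

lemma integrable_exp_three_mul_abs_mul_gaussian :
    Integrable fun u : ℝ => exp (3 * |u|) * exp (-(1 / 2) * u ^ 2) := by
  refine ((integrable_exp_neg_mul_sq (b := 1 / 4) (by norm_num)).const_mul (exp 9)).mono'
    (by fun_prop) (Filter.Eventually.of_forall fun u => ?_)
  rw [Real.norm_of_nonneg (by positivity), ← Real.exp_add, ← Real.exp_add, Real.exp_le_exp]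
  nlinarith [sq_nonneg (|u| - 6), sq_abs u]

/-- A bound for the `N × N` Vandermonde determinant, and for its perturbations, against the
standard Gaussian weight. -/
noncomputable def gaussianMajorant (N : ℕ) (y : Fin N → ℝ) : ℝ :=
  (N.factorial * (∏ i : Fin N, ((i : ℕ).factorial : ℝ)) * ∏ i, exp (3 * |y i|))
    * ∏ i, exp (-(1 / 2) * y i ^ 2)

lemma integrable_gaussianMajorant (N : ℕ) : Integrable (gaussianMajorant N) := by
  have h : Integrable fun y : Fin N → ℝ => ∏ i, (exp (3 * |y i|) * exp (-(1 / 2) * y i ^ 2)) :=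
    Integrable.fintype_prod fun _ => integrable_exp_three_mul_abs_mul_gaussian
  refine (h.const_mul (N.factorial * ∏ i : Fin N, ((i : ℕ).factorial : ℝ))).congr
    (Filter.Eventually.of_forall fun y => ?_)
  simp only [gaussianMajorant, Finset.prod_mul_distrib]
  ring

lemma gaussianMajorant_nonneg (N : ℕ) (y : Fin N → ℝ) : 0 ≤ gaussianMajorant N y := by
  unfold gaussianMajorant
  positivity

lemma abs_setIntegral_det_exp_mul_sub_le {N : ℕ} {x : Fin N → ℝ} (hx : StrictMono x) {M : ℝ}
    (hM : ∀ j, |x j| ≤ M) (hM0 : 0 ≤ M) (hM1 : M ≤ 1) :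
    |(∫ y in {y : Fin N → ℝ | StrictMono y}, (Matrix.of fun i j => exp (x j * y i)).det
          * ∏ i, exp (-(1 / 2) * y i ^ 2)) * (∏ j : Fin N, ((j : ℕ).factorial : ℝ))
        - (∏ i, ∏ j ∈ Ioi i, (x j - x i)) * weylGaussianIntegral N|
      ≤ (∏ i, ∏ j ∈ Ioi i, (x j - x i))
          * (M * ∫ y in {y : Fin N → ℝ | StrictMono y}, gaussianMajorant N y) := by
  set h := ∏ i, ∏ j ∈ Ioi i, (x j - x i) with hh
  have hpos : 0 ≤ h := Finset.prod_nonneg fun i _ => Finset.prod_nonneg fun j hj =>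
    sub_nonneg.2 (hx (Finset.mem_Ioi.1 hj)).le
  set P := ∏ j : Fin N, ((j : ℕ).factorial : ℝ) with hP
  have hPpos : 0 < P := by positivity
  let V : (Fin N → ℝ) → ℝ := fun y =>
    (Matrix.vandermonde y).det * ∏ i, exp (-(1 / 2) * y i ^ 2)
  let D : (Fin N → ℝ) → ℝ := fun y =>
    (Matrix.of fun i j => exp (x j * y i)).det * ∏ i, exp (-(1 / 2) * y i ^ 2)
  have hVm : Continuous V := by
    refine Continuous.mul (Continuous.matrix_det ?_) (by fun_prop)
    exact continuous_matrix fun i j => by simp only [Matrix.vandermonde_apply]; fun_prop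
  have hDm : Continuous D := by
    refine Continuous.mul (Continuous.matrix_det ?_) (by fun_prop)
    exact continuous_matrix fun i j => by simp only [Matrix.of_apply]; fun_prop
  have hw : ∀ y : Fin N → ℝ, 0 ≤ ∏ i, exp (-(1 / 2) * y i ^ 2) := fun y => by positivity
  have hVi : Integrable V := (integrable_gaussianMajorant N).mono' hVm.aestronglyMeasurable
    (Filter.Eventually.of_forall fun y => by
      rw [Real.norm_eq_abs, abs_mul, abs_of_nonneg (hw y)]
      exact mul_le_mul_of_nonneg_right (abs_det_vandermonde_le y) (hw y))
  have hbound : ∀ y, |D y * P - h * V y| ≤ h * (M * gaussianMajorant N y) := by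
    intro y
    obtain ⟨ξ, hξ, hdet⟩ := exists_det_exp_mul_prod_factorial_eq hx y (a := -M) (b := M)
      fun i => abs_le.1 (hM i)
    have hE := abs_det_pow_mul_exp_sub_det_vandermonde_le y (fun j => abs_le.2 (hξ j)) hM0 hM1
    rw [← hP, ← hh] at hdet
    have : D y * P - h * V y = h * (((Matrix.of fun i j : Fin N =>
        y i ^ (j : ℕ) * exp (ξ j * y i)).det - (Matrix.vandermonde y).det)
          * ∏ i, exp (-(1 / 2) * y i ^ 2)) := by
      linear_combination (∏ i, exp (-(1 / 2) * y i ^ 2)) * hdet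
    rw [this, abs_mul, abs_mul, abs_of_nonneg hpos, abs_of_nonneg (hw y), gaussianMajorant,
      ← mul_assoc M]
    exact mul_le_mul_of_nonneg_left (mul_le_mul_of_nonneg_right hE (hw y)) hpos
  have hBi : Integrable fun y => h * (M * gaussianMajorant N y) :=
    ((integrable_gaussianMajorant N).const_mul M).const_mul h
  have hdiff : Integrable fun y => D y * P - h * V y :=
    hBi.mono' ((hDm.mul_const P).sub (hVm.const_mul h)).aestronglyMeasurable
      (Filter.Eventually.of_forall hbound)
  have hDi : Integrable fun y => D y * P := by
    refine (hdiff.add (hVi.const_mul h)).congr (Filter.Eventually.of_forall fun y => ?_)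
    simp
  have hle := norm_integral_le_of_norm_le (f := fun y => D y * P - h * V y)
    (hBi.integrableOn (s := {y | StrictMono y})) (Filter.Eventually.of_forall hbound)
  rw [integral_sub hDi.integrableOn (hVi.const_mul h).integrableOn, integral_mul_const,
    integral_const_mul, integral_const_mul, integral_const_mul] at hle
  exact hle

lemma weylGaussianIntegral_pos (n : ℕ) : 0 < weylGaussianIntegral n := by
  have h := weylGaussianIntegral_mul n
  have hc : 0 < π ^ ((n : ℝ) / 2) * ∏ j ∈ Icc 1 n, Gamma j / Gamma (j / 2) := by
    refine mul_pos (by positivity) (Finset.prod_pos fun j hj => ?_)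
    have : (0 : ℝ) < j := by exact_mod_cast (Finset.mem_Icc.1 hj).1
    exact div_pos (Real.Gamma_pos_of_pos this) (Real.Gamma_pos_of_pos (by linarith))
  have hr : 0 < √(2 * π) ^ n * ∏ j ∈ range n, (j.factorial : ℝ) := by positivity
  rw [← h] at hr
  exact pos_of_mul_pos_left hr hc.le

open scoped Pointwise in
lemma setIntegral_det_heatKernel_eq {N : ℕ} {t : ℝ} (ht : 0 < t) (x : Fin N → ℝ) :
    (∫ y : Fin N → ℝ in {y | StrictMono y},
        Matrix.det (Matrix.of fun i j : Fin N => (√(2 * π * t))⁻¹ * exp (-(x j - y i) ^ 2 / (2 * t))))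
      = ((√(2 * π))⁻¹ ^ N * exp (-(1 / 2) * ∑ j, (x j / √t) ^ 2))
        * ∫ y : Fin N → ℝ in {y | StrictMono y},
            (Matrix.of fun i j => exp (x j / √t * y i)).det * ∏ i, exp (-(1 / 2) * y i ^ 2) := by
  have hs : 0 < √t := Real.sqrt_pos.2 ht
  have hsq : √t ^ 2 = t := Real.sq_sqrt ht.le
  have hset : √t • {y : Fin N → ℝ | StrictMono y} = {y | StrictMono y} := by
    ext y
    rw [Set.mem_smul_set_iff_inv_smul_mem₀ hs.ne']
    simp only [Set.mem_ofPred_eq, StrictMono, Pi.smul_apply, smul_eq_mul]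
    refine forall_congr' fun a => forall_congr' fun b => imp_congr_right fun _ => ?_
    exact mul_lt_mul_iff_right₀ (inv_pos.2 hs)
  have hscale := Measure.setIntegral_comp_smul_of_pos (volume : Measure (Fin N → ℝ))
    (fun y : Fin N → ℝ => Matrix.det (Matrix.of fun i j : Fin N =>
      (√(2 * π * t))⁻¹ * exp (-(x j - y i) ^ 2 / (2 * t)))) {y | StrictMono y} hs
  rw [hset, Module.finrank_fin_fun, smul_eq_mul, eq_inv_mul_iff_mul_eq₀ (by positivity)] at hscale
  rw [← hscale, ← integral_const_mul, ← integral_const_mul]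
  refine integral_congr_ae (Filter.Eventually.of_forall fun y => ?_)
  have hmat : (Matrix.of fun i j : Fin N =>
      (√(2 * π * t))⁻¹ * exp (-(x j - (√t • y) i) ^ 2 / (2 * t)))
      = Matrix.of fun i j : Fin N => ((√(2 * π * t))⁻¹ * exp (-(1 / 2) * y i ^ 2))
          * (Matrix.of fun i j : Fin N => exp (-(1 / 2) * (x j / √t) ^ 2)
            * (Matrix.of fun i j : Fin N => exp (x j / √t * y i)) i j) i j := by
    ext i j
    simp only [Matrix.of_apply, Pi.smul_apply, smul_eq_mul]
    rw [mul_assoc (√(2 * π * t))⁻¹, ← Real.exp_add, ← Real.exp_add]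
    congr 2
    have : -(x j - √t * y i) ^ 2 / (2 * t) = -(x j - √t * y i) ^ 2 / (2 * √t ^ 2) := by rw [hsq]
    rw [this]
    field_simp
    ring
  simp only [hmat]
  rw [Matrix.det_mul_column, Matrix.det_mul_row, Finset.prod_mul_distrib, ← Real.exp_sum,
    ← Real.exp_sum, Finset.mul_sum, Finset.prod_const, Finset.card_univ, Fintype.card_fin,
    Real.sqrt_mul (by positivity), mul_inv, mul_pow, inv_pow (√t)]
  field_simp

/-- Asymptotics of the noncolliding probability: as `|x|/√t → 0`,
`𝒩_N(t,x) = (1/c̄_N) h_N(x/√t) (1 + O(|x|/√t))`, where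
`𝒩_N(t,x) = ∫_{y₁<⋯<y_N} det((2πt)^{-1/2} e^{-(x_j-y_i)²/(2t)}) dy`,
`h_N(x) = ∏_{i<j}(x_j - x_i)` and `c̄_N = π^{N/2} ∏_{j=1}^N Γ(j)/Γ(j/2)`. -/
theorem noncolliding_probability_asymptotics (N : ℕ) :
    ∃ C > (0 : ℝ), ∃ ε > (0 : ℝ), ∀ (t : ℝ) (x : Fin N → ℝ),
      0 < t → StrictMono x → Real.sqrt (∑ i, x i ^ 2) / Real.sqrt t ≤ ε →
      ∃ r : ℝ, |r| ≤ C * (Real.sqrt (∑ i, x i ^ 2) / Real.sqrt t) ∧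
        (∫ y : Fin N → ℝ in {y | StrictMono y},
            Matrix.det (Matrix.of fun i j : Fin N =>
              (Real.sqrt (2 * π * t))⁻¹ * Real.exp (-(x j - y i) ^ 2 / (2 * t)))) =
          (π ^ ((N : ℝ) / 2) * ∏ j ∈ Finset.Icc 1 N, Real.Gamma j / Real.Gamma (j / 2))⁻¹ *
            (∏ i : Fin N, ∏ j ∈ Finset.Ioi i,
              (x j / Real.sqrt t - x i / Real.sqrt t)) * (1 + r) := by
  set Z := weylGaussianIntegral N with hZ
  have hZ0 : 0 < Z := weylGaussianIntegral_pos N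
  have hZc := weylGaussianIntegral_mul N
  rw [← hZ] at hZc
  set K := ∫ y in {y : Fin N → ℝ | StrictMono y}, gaussianMajorant N y with hK
  have hK0 : 0 ≤ K := integral_nonneg fun y => gaussianMajorant_nonneg N y
  refine ⟨1 + K / Z, by positivity, 1, one_pos, fun t x ht hx hsmall => ?_⟩
  set c := π ^ ((N : ℝ) / 2) * ∏ j ∈ Finset.Icc 1 N, Real.Gamma j / Real.Gamma (j / 2)
  have ht' : 0 < √t := Real.sqrt_pos.2 ht
  set s := √(∑ i, x i ^ 2) / √t with hs
  have hs0 : 0 ≤ s := by positivity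
  have hs2 : ∑ j, (x j / √t) ^ 2 = s ^ 2 := by
    rw [hs, div_pow, Real.sq_sqrt (Finset.sum_nonneg fun _ _ => sq_nonneg _), Finset.sum_div]
    simp only [div_pow]
  have hxs : ∀ j, |x j / √t| ≤ s := fun j => abs_le_of_sq_le_sq
    ((Finset.single_le_sum (f := fun j => (x j / √t) ^ 2) (fun _ _ => sq_nonneg _)
      (Finset.mem_univ j)).trans_eq hs2) hs0
  have hmono : StrictMono fun j => x j / √t := fun i j hij =>
    div_lt_div_of_pos_right (hx hij) ht'
  have hmain := abs_setIntegral_det_exp_mul_sub_le hmono hxs hs0 hsmall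
  rw [setIntegral_det_heatKernel_eq ht x, hs2]
  set F := ∫ y : Fin N → ℝ in {y | StrictMono y},
    (Matrix.of fun i j => exp (x j / √t * y i)).det * ∏ i, exp (-(1 / 2) * y i ^ 2)
  set h := ∏ i : Fin N, ∏ j ∈ Finset.Ioi i, (x j / √t - x i / √t) with hh
  have hpos : 0 < h := Finset.prod_pos fun i _ => Finset.prod_pos fun j hj =>
    sub_pos.2 (hmono (Finset.mem_Ioi.1 hj))
  rw [Finset.prod_range] at hZc
  set P := ∏ j : Fin N, ((j : ℕ).factorial : ℝ) with hP
  have hP0 : 0 < P := by positivity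
  have hc0 : c ≠ 0 := by
    rintro h0
    rw [h0, mul_zero] at hZc
    exact absurd hZc (by positivity)
  obtain ⟨R, hR⟩ : ∃ R, F * P = h * (Z + R) := ⟨F * P / h - Z, by field_simp; ring⟩
  rw [hR, show h * (Z + R) - h * Z = h * R by ring, abs_mul, abs_of_pos hpos] at hmain
  have hRle : |R| ≤ s * K := le_of_mul_le_mul_left hmain hpos
  have he1 : exp (-(1 / 2) * s ^ 2) ≤ 1 := Real.exp_le_one_iff.2 (by nlinarith)
  have he2 := Real.add_one_le_exp (-(1 / 2) * s ^ 2)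
  refine ⟨exp (-(1 / 2) * s ^ 2) * (1 + R / Z) - 1, ?_, ?_⟩
  · have h1 : |exp (-(1 / 2) * s ^ 2) - 1| ≤ s := by
      rw [abs_le]
      constructor <;> nlinarith
    have h2 : |exp (-(1 / 2) * s ^ 2) * (R / Z)| ≤ s * (K / Z) := by
      rw [abs_mul, abs_of_pos (Real.exp_pos _), abs_div, abs_of_pos hZ0, ← mul_div_assoc s]
      calc _ ≤ 1 * (|R| / Z) := by gcongr
        _ ≤ _ := by rw [one_mul]; gcongr
    calc _ = |(exp (-(1 / 2) * s ^ 2) - 1) + exp (-(1 / 2) * s ^ 2) * (R / Z)| := by ring_nf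
      _ ≤ s + s * (K / Z) := (abs_add_le _ _).trans (add_le_add h1 h2)
      _ = _ := by ring
  · have hF : F = h * (Z + R) / P := by rw [← hR]; field_simp
    have hP' : P = Z * c / √(2 * π) ^ N := by rw [hZc]; field_simp
    rw [hF, hP', inv_pow]
    field_simp
    ring
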